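/- Let G be a finite simple graph. If diadem(G) = corona(G), then G is a König-Egerváry graph. -/

import Mathlib

/-- `S` is an independent set in `G`: no two of its vertices are adjacent. -/
def IndepSet {V : Type*} (G : SimpleGraph V) (S : Set V) : Prop :=
  ∀ ⦃u⦄, u ∈ S → ∀ ⦃v⦄, v ∈ S → ¬G.Adj u v

/-- The independence number `α(G)`. -/
noncomputable def indNum {V : Type*} (G : SimpleGraph V) : ℕ :=
  sSup {n : ℕ | ∃ S : Set V, IndepSet G S ∧ S.ncard = n}

/-- `Ω(G)`: the family of maximum independent sets of `G`. -/
def maxIndepFam {V : Type*} (G : SimpleGraph V) : Set (Set V) :=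
  {S | IndepSet G S ∧ S.ncard = indNum G}

/-- `N(X)`: the neighborhood of a set of vertices. -/
def nbhd {V : Type*} (G : SimpleGraph V) (X : Set V) : Set V :=
  {v | ∃ x ∈ X, G.Adj v x}

/-- `N[X] = N(X) ∪ X`: the closed neighborhood of a set of vertices. -/
def closedNbhd {V : Type*} (G : SimpleGraph V) (X : Set V) : Set V :=
  nbhd G X ∪ X

/-- The difference `d(X) = |X| - |N(X)|`. -/
noncomputable def diffd {V : Type*} (G : SimpleGraph V) (X : Set V) : ℤ :=
  (X.ncard : ℤ) - ((nbhd G X).ncard : ℤ)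

/-- The critical difference `d(G) = max {d(X) : X ⊆ V(G)}`. -/
noncomputable def critDiff {V : Type*} (G : SimpleGraph V) : ℤ :=
  sSup {d : ℤ | ∃ X : Set V, diffd G X = d}

/-- `X` is a critical set if `d(X) = d(G)`. -/
def IsCritical {V : Type*} (G : SimpleGraph V) (X : Set V) : Prop :=
  diffd G X = critDiff G

/-- `MaxCritIndep(G)`: the family of critical independent sets of maximum cardinality. -/
def maxCritIndepFam {V : Type*} (G : SimpleGraph V) : Set (Set V) :=
  {S | IndepSet G S ∧ IsCritical G S ∧
    ∀ T : Set V, IndepSet G T → IsCritical G T → T.ncard ≤ S.ncard}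

/-- The critical independence number `α'(G)`. -/
noncomputable def critIndNum {V : Type*} (G : SimpleGraph V) : ℕ :=
  sSup {n : ℕ | ∃ S : Set V, IndepSet G S ∧ IsCritical G S ∧ S.ncard = n}

/-- `ker(G)`: the intersection of all critical independent sets. -/
def kerSet {V : Type*} (G : SimpleGraph V) : Set V :=
  ⋂₀ {A : Set V | IndepSet G A ∧ IsCritical G A}

/-- `nucleus(G)`: the intersection of all maximum critical independent sets. -/
def nucleus {V : Type*} (G : SimpleGraph V) : Set V :=
  ⋂₀ maxCritIndepFam G

/-- `diadem(G)`: the union of all maximum critical independent sets. -/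
def diadem {V : Type*} (G : SimpleGraph V) : Set V :=
  ⋃₀ maxCritIndepFam G

/-- `core(G)`: the intersection of all maximum independent sets. -/
def coreSet {V : Type*} (G : SimpleGraph V) : Set V :=
  ⋂₀ maxIndepFam G

/-- `corona(G)`: the union of all maximum independent sets. -/
def coronaSet {V : Type*} (G : SimpleGraph V) : Set V :=
  ⋃₀ maxIndepFam G

/-- A matching in `G`: a set of pairwise non-incident edges of `G`. -/
def IsMatchingSet {V : Type*} (G : SimpleGraph V) (M : Set (Sym2 V)) : Prop :=
  M ⊆ G.edgeSet ∧ M.Pairwise fun e f => ∀ v, v ∈ e → v ∉ f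

/-- The matching number `μ(G)`. -/
noncomputable def matchNum {V : Type*} (G : SimpleGraph V) : ℕ :=
  sSup {n : ℕ | ∃ M : Set (Sym2 V), IsMatchingSet G M ∧ M.ncard = n}

/-- `G` is a König-Egerváry graph if `α(G) + μ(G) = |V(G)|`. -/
def IsKonigEgervary {V : Type*} (G : SimpleGraph V) : Prop :=
  indNum G + matchNum G = Nat.card V

/-- `Γ` is a König-Egerváry collection: a family of independent sets with
`|⋂Γ| + |⋃Γ| = 2α(G)`. -/
def IsKECollection {V : Type*} (G : SimpleGraph V) (Γ : Set (Set V)) : Prop :=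
  (∀ S ∈ Γ, IndepSet G S) ∧ (⋂₀ Γ).ncard + (⋃₀ Γ).ncard = 2 * indNum G

section KonigEgervaryAux

variable {V : Type*} {G : SimpleGraph V} {A B X Y T : Set V}

lemma nbhd_mono (h : X ⊆ Y) : nbhd G X ⊆ nbhd G Y :=
  fun _ ⟨x, hx, hv⟩ => ⟨x, h hx, hv⟩

lemma IndepSet.disjoint_nbhd (h : IndepSet G A) : Disjoint A (nbhd G A) :=
  Set.disjoint_left.2 fun _ hv ⟨_, hx, hvx⟩ => h hv hx hvx

lemma IndepSet.union_diff_nbhd (hA : IndepSet G A) (hB : IndepSet G B) :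
    IndepSet G (A ∪ B \ nbhd G A) := by
  rintro u (hu | hu) v (hv | hv) huv
  · exact hA hu hv huv
  · exact hv.2 ⟨u, hu, huv.symm⟩
  · exact hu.2 ⟨v, hv, huv⟩
  · exact hB hu.1 hv.1 huv

variable [Finite V]

lemma diffd_values_finite (G : SimpleGraph V) : {d : ℤ | ∃ X : Set V, diffd G X = d}.Finite :=
  Set.finite_range (diffd G)

lemma diffd_le_critDiff (G : SimpleGraph V) (X : Set V) : diffd G X ≤ critDiff G :=
  le_csSup (diffd_values_finite G).bddAbove ⟨X, rfl⟩

lemma exists_isCritical (G : SimpleGraph V) : ∃ X, IsCritical G X :=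
  Set.Nonempty.csSup_mem (s := {d : ℤ | ∃ X : Set V, diffd G X = d}) ⟨_, ∅, rfl⟩
    (diffd_values_finite G)

lemma IsCritical.diff_nbhd (h : IsCritical G X) : IsCritical G (X \ nbhd G X) := by
  refine le_antisymm (diffd_le_critDiff _ _) ?_
  rw [← h]
  have hsub : nbhd G (X \ nbhd G X) ⊆ nbhd G X \ X := fun u ⟨x, hx, hux⟩ =>
    ⟨⟨x, hx.1, hux⟩, fun hu => hx.2 ⟨u, hu, hux.symm⟩⟩
  have h₁ := Set.ncard_le_ncard hsub
  have h₂ := Set.ncard_inter_add_ncard_sdiff_eq_ncard X (nbhd G X)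
  have h₃ := Set.ncard_inter_add_ncard_sdiff_eq_ncard (nbhd G X) X
  rw [Set.inter_comm] at h₃
  unfold diffd
  omega

lemma exists_mem_maxCritIndepFam (G : SimpleGraph V) : ∃ A, A ∈ maxCritIndepFam G := by
  obtain ⟨X, hX⟩ := exists_isCritical G
  obtain ⟨A, hA, hmax⟩ := Set.exists_max_image {A : Set V | IndepSet G A ∧ IsCritical G A}
    Set.ncard (Set.toFinite _)
    ⟨X \ nbhd G X, fun u hu v hv huv => hu.2 ⟨v, hv.1, huv⟩, hX.diff_nbhd⟩
  exact ⟨A, hA.1, hA.2, fun T h₁ h₂ => hmax T ⟨h₁, h₂⟩⟩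

/-- Hall's condition for the neighborhood of a critical set. -/
lemma IsCritical.ncard_le_ncard_nbhd_inter (h : IsCritical G A) (hY : Y ⊆ nbhd G A) :
    Y.ncard ≤ (nbhd G Y ∩ A).ncard := by
  have hle := diffd_le_critDiff G (A \ nbhd G Y)
  rw [← h] at hle
  have hsub : nbhd G (A \ nbhd G Y) ⊆ nbhd G A \ Y := fun u ⟨x, hx, hux⟩ =>
    ⟨⟨x, hx.1, hux⟩, fun hu => hx.2 ⟨u, hu, hux.symm⟩⟩
  have h₁ := Set.ncard_le_ncard hsub
  have h₂ := Set.ncard_inter_add_ncard_sdiff_eq_ncard A (nbhd G Y)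
  have h₃ := Set.ncard_sdiff_add_ncard_of_subset hY
  rw [Set.inter_comm] at h₂
  unfold diffd at hle
  omega

/-- A critical independent set is a maximum independent set of its closed neighborhood. -/
lemma IsCritical.ncard_le_of_subset_closedNbhd (h : IsCritical G A) (hT : IndepSet G T)
    (hTA : T ⊆ closedNbhd G A) : T.ncard ≤ A.ncard := by
  have h₁ := h.ncard_le_ncard_nbhd_inter (Y := T ∩ nbhd G A) Set.inter_subset_right
  have hsub : nbhd G (T ∩ nbhd G A) ∩ A ⊆ A \ T := fun u ⟨⟨x, hx, hux⟩, hu⟩ =>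
    ⟨hu, fun huT => hT huT hx.1 hux⟩
  have h₂ := Set.ncard_le_ncard hsub
  have h₃ := Set.ncard_inter_add_ncard_sdiff_eq_ncard T (nbhd G A)
  have h₄ := Set.ncard_le_ncard (s := T \ nbhd G A) (t := A ∩ T) fun u hu =>
    ⟨(hTA hu.1).resolve_left hu.2, hu.1⟩
  have h₅ := Set.ncard_inter_add_ncard_sdiff_eq_ncard A T
  omega

lemma diffd_add_diffd_le (G : SimpleGraph V) (X Y : Set V) :
    diffd G X + diffd G Y ≤ diffd G (X ∪ Y) + diffd G (X ∩ Y) := by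
  have hunion : nbhd G (X ∪ Y) ⊆ nbhd G X ∪ nbhd G Y := by
    rintro u ⟨x, hx | hx, hux⟩
    exacts [Or.inl ⟨x, hx, hux⟩, Or.inr ⟨x, hx, hux⟩]
  have hinter : nbhd G (X ∩ Y) ⊆ nbhd G X ∩ nbhd G Y :=
    Set.subset_inter (nbhd_mono Set.inter_subset_left) (nbhd_mono Set.inter_subset_right)
  have h₁ := Set.ncard_le_ncard hunion
  have h₂ := Set.ncard_le_ncard hinter
  have h₃ := Set.ncard_union_add_ncard_inter X Y
  have h₄ := Set.ncard_union_add_ncard_inter (nbhd G X) (nbhd G Y)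
  unfold diffd
  omega

lemma IsCritical.union (hX : IsCritical G X) (hY : IsCritical G Y) : IsCritical G (X ∪ Y) := by
  have h₁ := diffd_add_diffd_le G X Y
  have h₂ := diffd_le_critDiff G (X ∪ Y)
  have h₃ := diffd_le_critDiff G (X ∩ Y)
  unfold IsCritical at *
  omega

lemma IsCritical.union_diff_nbhd (hA : IsCritical G A) (hAi : IndepSet G A)
    (hB : IsCritical G B) : IsCritical G (A ∪ B \ nbhd G A) := by
  refine le_antisymm (diffd_le_critDiff _ _) ?_
  have hAB := hA.union hB
  rw [← hAB]
  have hall := hA.ncard_le_ncard_nbhd_inter (Y := B ∩ nbhd G A) Set.inter_subset_right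
  have hN : nbhd G (A ∪ B \ nbhd G A) ⊆ nbhd G (A ∪ B) \ (nbhd G (B ∩ nbhd G A) ∩ A) := by
    rintro u ⟨x, hx, hux⟩
    refine ⟨⟨x, hx.imp id And.left, hux⟩, fun hu => ?_⟩
    rcases hx with hx | hx
    · exact hAi hu.2 hx hux
    · exact hx.2 ⟨u, hu.2, hux.symm⟩
  have hN' : nbhd G (B ∩ nbhd G A) ∩ A ⊆ nbhd G (A ∪ B) :=
    Set.inter_subset_left.trans
      (nbhd_mono (Set.inter_subset_left.trans Set.subset_union_right))
  have hcover : A ∪ B ⊆ (A ∪ B \ nbhd G A) ∪ (B ∩ nbhd G A) := by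
    rintro u (hu | hu)
    · exact Or.inl (Or.inl hu)
    · by_cases h : u ∈ nbhd G A
      · exact Or.inr ⟨hu, h⟩
      · exact Or.inl (Or.inr ⟨hu, h⟩)
  have h₁ := Set.ncard_le_ncard hN
  have h₂ := Set.ncard_sdiff_add_ncard_of_subset hN'
  have h₃ := (Set.ncard_le_ncard hcover).trans (Set.ncard_union_le _ _)
  unfold diffd
  omega

lemma diadem_subset_closedNbhd (hA : A ∈ maxCritIndepFam G) : diadem G ⊆ closedNbhd G A := by
  rintro v ⟨B, hB, hv⟩
  by_contra hvA
  have hle := hA.2.2 _ (hA.1.union_diff_nbhd hB.1) (hA.2.1.union_diff_nbhd hA.1 hB.2.1)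
  have hlt : A ⊂ A ∪ B \ nbhd G A := Set.ssubset_iff_subset_ne.2 ⟨Set.subset_union_left,
    fun h => hvA (Or.inr (h ▸ Or.inr ⟨hv, fun h' => hvA (Or.inl h')⟩))⟩
  exact absurd hle (Set.ncard_lt_ncard hlt).not_ge

lemma indepSet_ncards_finite (G : SimpleGraph V) :
    {n : ℕ | ∃ S : Set V, IndepSet G S ∧ S.ncard = n}.Finite :=
  (Set.finite_range (Set.ncard (α := V))).subset fun _ ⟨S, _, hS⟩ => ⟨S, hS⟩

lemma IndepSet.ncard_le_indNum (hT : IndepSet G T) : T.ncard ≤ indNum G :=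
  le_csSup (indepSet_ncards_finite G).bddAbove ⟨T, hT, rfl⟩

lemma exists_mem_maxIndepFam (G : SimpleGraph V) : ∃ S, S ∈ maxIndepFam G :=
  Set.Nonempty.csSup_mem (s := {n : ℕ | ∃ S : Set V, IndepSet G S ∧ S.ncard = n})
    ⟨_, ∅, fun _ h => h.elim, rfl⟩ (indepSet_ncards_finite G)

lemma IsMatchingSet.ncard_le_ncard_compl {M : Set (Sym2 V)} (hM : IsMatchingSet G M)
    (hA : IndepSet G A) : M.ncard ≤ Aᶜ.ncard := by
  classical
  have hex : ∀ e ∈ M, ∃ v ∈ e, v ∉ A := by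
    intro e he
    induction e with
    | h u v =>
      have huv : G.Adj u v := hM.1 he
      by_cases hu : u ∈ A
      · exact ⟨v, Sym2.mem_mk_right u v, fun hv => hA hu hv huv⟩
      · exact ⟨u, Sym2.mem_mk_left u v, hu⟩
  choose f hf hfA using hex
  refine Set.ncard_le_ncard_of_injOn (fun e => if he : e ∈ M then f e he else e.out.1) ?_ ?_
  · intro e he
    simpa [he] using hfA e he
  · intro e he e₂ he₂ heq
    simp only [he, he₂, dif_pos] at heq
    by_contra hne
    exact hM.2 he he₂ hne _ (hf e he) (heq ▸ hf e₂ he₂)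

/-- By Hall's theorem, a critical independent set yields a matching saturating its
neighborhood. -/
lemma IsCritical.exists_isMatchingSet (h : IsCritical G A) (hA : IndepSet G A) :
    ∃ M, IsMatchingSet G M ∧ M.ncard = (nbhd G A).ncard := by
  classical
  have := Fintype.ofFinite V
  obtain ⟨f, hinj, hf⟩ := (Finset.all_card_le_biUnion_card_iff_exists_injective
    (fun u : nbhd G A => (nbhd G {u.1} ∩ A).toFinset)).1 (by
      intro s
      have hall := h.ncard_le_ncard_nbhd_inter (Y := Subtype.val '' (s : Set (nbhd G A)))
        (by rintro _ ⟨u, -, rfl⟩; exact u.2)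
      rw [Set.ncard_image_of_injective _ Subtype.val_injective, Set.ncard_coe_finset] at hall
      refine hall.trans ?_
      rw [← Set.ncard_coe_finset]
      refine Set.ncard_le_ncard ?_
      rintro v ⟨⟨_, ⟨u, hu, rfl⟩, hvu⟩, hv⟩
      exact Finset.mem_coe.2 (Finset.mem_biUnion.2
        ⟨u, hu, Set.mem_toFinset.2 ⟨⟨u.1, rfl, hvu⟩, hv⟩⟩))
  have hfA : ∀ u, f u ∈ A := fun u => (Set.mem_toFinset.1 (hf u)).2
  have hadj : ∀ u : nbhd G A, G.Adj u.1 (f u) := fun u => by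
    obtain ⟨x, rfl, hx⟩ := (Set.mem_toFinset.1 (hf u)).1
    exact hx.symm
  have hne : ∀ u u' : nbhd G A, u.1 ≠ f u' := fun u u' heq =>
    Set.disjoint_left.1 hA.disjoint_nbhd (hfA u') (heq ▸ u.2)
  have hdisj : ∀ (u u' : nbhd G A) (v : V), v ∈ s(u.1, f u) → v ∈ s(u'.1, f u') → u = u' := by
    intro u u' v hv hv'
    rw [Sym2.mem_iff] at hv hv'
    rcases hv with rfl | rfl <;> rcases hv' with h' | h'
    · exact Subtype.ext h'
    · exact (hne _ _ h').elim
    · exact (hne _ _ h'.symm).elim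
    · exact hinj h'
  refine ⟨Set.range fun u : nbhd G A => s(u.1, f u), ⟨?_, ?_⟩, ?_⟩
  · rintro _ ⟨u, rfl⟩
    exact hadj u
  · rintro _ ⟨u, rfl⟩ _ ⟨u', rfl⟩ hee v hv hv'
    exact hee (by rw [hdisj u u' v hv hv'])
  · rw [← Set.image_univ, Set.ncard_image_of_injective, Set.ncard_univ]
    · rfl
    · intro u u' heq
      have heq' : s(u.1, f u) = s(u'.1, f u') := heq
      exact hdisj u u' u.1 (Sym2.mem_mk_left _ _) (heq' ▸ Sym2.mem_mk_left _ _)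

lemma IsCritical.isKonigEgervary (h : IsCritical G A) (hA : IndepSet G A)
    (huniv : closedNbhd G A = Set.univ) : IsKonigEgervary G := by
  have hind : indNum G = A.ncard := by
    obtain ⟨T, hT, hTc⟩ := exists_mem_maxIndepFam G
    exact le_antisymm
      (hTc ▸ h.ncard_le_of_subset_closedNbhd hT (huniv ▸ Set.subset_univ T)) hA.ncard_le_indNum
  have hcompl : nbhd G A = Aᶜ :=
    (IsCompl.compl_eq ⟨hA.disjoint_nbhd,
      codisjoint_iff.2 ((Set.union_comm _ _).trans huniv)⟩).symm
  have hmatch : matchNum G = Aᶜ.ncard := by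
    obtain ⟨M, hM, hMc⟩ := h.exists_isMatchingSet hA
    have hub : ∀ n ∈ {n : ℕ | ∃ M : Set (Sym2 V), IsMatchingSet G M ∧ M.ncard = n},
        n ≤ Aᶜ.ncard := by
      rintro _ ⟨M, hM, rfl⟩
      exact hM.ncard_le_ncard_compl hA
    exact le_antisymm (csSup_le ⟨_, M, hM, rfl⟩ hub)
      (le_csSup ⟨_, hub⟩ ⟨M, hM, by rw [hMc, hcompl]⟩)
  rw [IsKonigEgervary, hind, hmatch, Set.ncard_add_ncard_compl]

end KonigEgervaryAux

/-- If `diadem(G) = corona(G)`, then `G` is a König-Egerváry graph. -/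
theorem stmt11 {V : Type*} [Fintype V] (G : SimpleGraph V)
    (h : diadem G = coronaSet G) :
    IsKonigEgervary G := by
  obtain ⟨A, hA⟩ := exists_mem_maxCritIndepFam G
  obtain ⟨T, hT⟩ := exists_mem_maxIndepFam G
  have hTA : T ⊆ closedNbhd G A :=
    (Set.subset_sUnion_of_mem hT).trans (h.symm.subset.trans (diadem_subset_closedNbhd hA))
  have hle := hA.2.1.ncard_le_of_subset_closedNbhd hT.1 hTA
  refine hA.2.1.isKonigEgervary hA.1 (Set.eq_univ_of_forall fun v => ?_)
  by_contra hv
  have hvA : v ∉ A := fun hvA => hv (Or.inr hvA)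
  have hins : IndepSet G (A ∪ {v} \ nbhd G A) := hA.1.union_diff_nbhd (by
    rintro _ rfl _ rfl
    exact G.loopless.irrefl _)
  have hv' : insert v A ⊆ A ∪ {v} \ nbhd G A := by
    rintro u (rfl | hu)
    · exact Or.inr ⟨rfl, fun hN => hv (Or.inl hN)⟩
    · exact Or.inl hu
  have h₁ := (Set.ncard_le_ncard hv').trans hins.ncard_le_indNum
  rw [Set.ncard_insert_of_notMem hvA, ← hT.2] at h₁
  omega
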